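/- In the linear regression setting with K auxiliary tasks weighted by λ_1,…,λ_K ≥ 0 and Λ = Σ_{k=1}^K λ_k, let w̄ = E_D[ŵ_D] and Δ = ŵ_D − w̄. Then E_D[Δ Δ^T] = (1/(1+Λ))²·(σ_m² + Σ_{k=1}^K λ_k² σ_k²)·Σ_x^{-1}/(N−d−1), and consequently the variance term of the generalization error equals E_{D,x}[(x^T Δ)²] = ((σ_m² + Σ_{k=1}^K λ_k² σ_k²)/(1+Λ)²)·d/(N−d−1). -/

import Mathlib

open MeasureTheory ProbabilityTheory Matrix

noncomputable section

namespace Stmt17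

/-- `(XᵀX)⁻¹Xᵀ`, the OLS map. -/
def pinv {N d : ℕ} (X : Matrix (Fin N) (Fin d) ℝ) : Matrix (Fin d) (Fin N) ℝ :=
  (Xᵀ * X)⁻¹ * Xᵀ

/-- Law of a vector of `n` i.i.d. centered Gaussians with variance `v`. -/
def gaussianVec (n : ℕ) (v : ℝ) : Measure (Fin n → ℝ) :=
  Measure.pi fun _ => gaussianReal 0 (Real.toNNReal v)

/-- Training sample space: (standard-Gaussian feature source, auxiliary noises, main noise). -/
abbrev Sample (N d K : ℕ) : Type :=
  (Fin N → Fin d → ℝ) × (Fin K → Fin N → ℝ) × (Fin N → ℝ)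

/-- Joint law of the training data: all sources independent Gaussians. -/
def P (N d K : ℕ) (σm : ℝ) (σa : Fin K → ℝ) : Measure (Sample N d K) :=
  (Measure.pi fun _ : Fin N => gaussianVec d 1).prod
    ((Measure.pi fun k : Fin K => gaussianVec N (σa k ^ 2)).prod
      (gaussianVec N (σm ^ 2)))

/-- Design matrix `X` whose rows are i.i.d. `N(0, A Aᵀ)`. -/
def Xmat {N d K : ℕ} (A : Matrix (Fin d) (Fin d) ℝ) (ω : Sample N d K) :
    Matrix (Fin N) (Fin d) ℝ :=
  Matrix.of ω.1 * Aᵀ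

/-- Main-task labels `Y_m = X w*_m + ε_m`. -/
def Ym {N d K : ℕ} (A : Matrix (Fin d) (Fin d) ℝ) (wm : Fin d → ℝ) (ω : Sample N d K) :
    Fin N → ℝ :=
  Xmat A ω *ᵥ wm + ω.2.2

/-- Auxiliary labels `Y_k = X w*_k + ε_k`. -/
def Ya {N d K : ℕ} (A : Matrix (Fin d) (Fin d) ℝ) (wk : Fin K → Fin d → ℝ) (k : Fin K)
    (ω : Sample N d K) : Fin N → ℝ :=
  Xmat A ω *ᵥ wk k + ω.2.1 k

/-- The weighted least-squares estimator. -/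
def wHat {N d K : ℕ} (A : Matrix (Fin d) (Fin d) ℝ) (wm : Fin d → ℝ)
    (wk : Fin K → Fin d → ℝ) (lam : Fin K → ℝ) (ω : Sample N d K) : Fin d → ℝ :=
  (1 / (1 + ∑ k, lam k)) •
    (pinv (Xmat A ω) *ᵥ Ym A wm ω + ∑ k, lam k • (pinv (Xmat A ω) *ᵥ Ya A wk k ω))

/-- The expected estimator `w̄ = E_D[ŵ_D]` (componentwise expectation). -/
def wBar (N d K : ℕ) (A : Matrix (Fin d) (Fin d) ℝ) (wm : Fin d → ℝ)
    (wk : Fin K → Fin d → ℝ) (lam : Fin K → ℝ) (σm : ℝ) (σa : Fin K → ℝ) : Fin d → ℝ :=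
  fun i => ∫ ω, wHat A wm wk lam ω i ∂(P N d K σm σa)



lemma inv_eq_lint (q : ℝ) (hq : 0 ≤ q) :
    (ENNReal.ofReal q)⁻¹ = ∫⁻ t in Set.Ioi (0:ℝ), ENNReal.ofReal (Real.exp (-t * q)) := by
  rcases hq.eq_or_lt with rfl | h
  · simp
  · rw [← ofReal_integral_eq_lintegral_ofReal]
    · have := integral_exp_mul_Ioi (a := -q) (by linarith) 0
      have e : ∀ t : ℝ, -t * q = -q * t := fun t => by ring
      simp_rw [e, this]
      rw [← ENNReal.ofReal_inv_of_pos h]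
      congr 1
      simp 
    · have := integrableOn_exp_mul_Ioi (a := -q) (by linarith) 0
      have e : ∀ t : ℝ, -t * q = -q * t := fun t => by ring
      simp_rw [e]; exact this
    · exact Filter.Eventually.of_forall fun t => (Real.exp_pos _).le

lemma gauss_exp_sq (t : ℝ) (ht : 0 < t) :
    ∫ x, Real.exp (-t * x ^ 2) ∂(gaussianReal 0 1) = (1 + 2 * t) ^ (-(1/2) : ℝ) := by
  rw [integral_gaussianReal_eq_integral_smul (by simp)]
  have : ∀ x : ℝ, gaussianPDFReal 0 1 x • Real.exp (-t * x ^ 2) =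
      (√(2 * Real.pi))⁻¹ * Real.exp (-(1/2 + t) * x ^ 2) := by
    intro x
    simp only [gaussianPDFReal, smul_eq_mul, NNReal.coe_one, mul_one, sub_zero]
    rw [mul_assoc, ← Real.exp_add]; ring_nf
  simp_rw [this]
  rw [integral_const_mul, integral_gaussian, ← Real.sqrt_inv, ← Real.sqrt_mul (by positivity),
    Real.rpow_neg (by positivity), ← Real.sqrt_eq_rpow, ← Real.sqrt_inv]
  congr 1
  have := Real.pi_pos
  field_simp
  try ring

lemma gaussvec_exp_sq (n : ℕ) (t : ℝ) (ht : 0 < t) :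
    ∫⁻ z : Fin n → ℝ, ENNReal.ofReal (Real.exp (-t * ∑ i, z i ^ 2))
      ∂(Measure.pi fun _ => gaussianReal 0 1) = ENNReal.ofReal ((1 + 2 * t) ^ (-(n/2) : ℝ)) := by
  rw [← ofReal_integral_eq_lintegral_ofReal]
  · congr 1
    simp_rw [Finset.mul_sum, Real.exp_sum]
    rw [integral_fintype_prod_eq_prod (f := fun _ x => Real.exp (-t * x ^ 2))]
    simp_rw [gauss_exp_sq t ht]
    rw [Finset.prod_const, ← Real.rpow_natCast, ← Real.rpow_mul (by positivity)]
    congr 1; simp; ring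
  · refine Integrable.of_bound (C := 1) (Measurable.aestronglyMeasurable (by fun_prop)) (Filter.Eventually.of_forall fun z => ?_)
    rw [Real.norm_of_nonneg (Real.exp_pos _).le]
    apply Real.exp_le_one_iff.2
    have : 0 ≤ ∑ i, z i ^ 2 := Finset.sum_nonneg fun i _ => sq_nonneg _
    nlinarith
  · exact Filter.Eventually.of_forall fun t => (Real.exp_pos _).le

lemma inv_chi (n : ℕ) (hn : 2 < n) :
    ∫⁻ z : Fin n → ℝ, (ENNReal.ofReal (∑ i, z i ^ 2))⁻¹
      ∂(Measure.pi fun _ => gaussianReal 0 1) = ENNReal.ofReal (1 / ((n:ℝ) - 2)) := by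
  have h0 : ∀ z : Fin n → ℝ, 0 ≤ ∑ i, z i ^ 2 := fun z => Finset.sum_nonneg fun i _ => sq_nonneg _
  simp_rw [fun z => inv_eq_lint _ (h0 z)]
  rw [lintegral_lintegral_swap]
  · rw [setLIntegral_congr_fun measurableSet_Ioi
      (fun t ht => gaussvec_exp_sq n t ht)]
    have hn' : (2:ℝ) < n := by exact_mod_cast hn
    have hd : ∀ x ∈ Set.Ici (0:ℝ), HasDerivAt (fun t : ℝ => (1 + 2 * t) ^ (-(n/2) + 1: ℝ) / (2 - n))
        ((1 + 2 * x) ^ (-(n/2) : ℝ)) x := by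
      intro x hx
      have hx' : (0:ℝ) ≤ x := hx
      have h1 : HasDerivAt (fun t : ℝ => 1 + 2 * t) 2 x := by
        simpa using ((hasDerivAt_id x).const_mul 2).const_add 1
      have := (h1.rpow_const (p := (-(n/2) + 1: ℝ)) (Or.inl (by positivity))).div_const (2 - n)
      refine this.congr_deriv ?_
      have : (2:ℝ) - n ≠ 0 := by linarith
      rw [add_sub_cancel_right, div_eq_iff this]; ring
    have hp : ∀ x ∈ Set.Ioi (0:ℝ), 0 ≤ (1 + 2 * x) ^ (-(n/2) : ℝ) := by
      intro x hx
      have hx' : (0:ℝ) < x := hx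
      positivity
    have hl : Filter.Tendsto (fun t : ℝ => (1 + 2 * t) ^ (-(n/2) + 1: ℝ) / (2 - n)) Filter.atTop
        (nhds 0) := by
      have h2 := tendsto_rpow_neg_atTop (y := (n/2 - 1 : ℝ)) (by linarith)
      have h3 : Filter.Tendsto (fun t : ℝ => 1 + 2 * t) Filter.atTop Filter.atTop :=
        Filter.tendsto_atTop_add_const_left _ _ (Filter.tendsto_id.const_mul_atTop (by norm_num))
      have := (h2.comp h3).div_const (2 - n : ℝ)
      simp only [zero_div] at this
      convert this using 2
      simp only [Function.comp]
      congr 2; ring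
    rw [← ofReal_integral_eq_lintegral_ofReal]
    · rw [integral_Ioi_of_hasDerivAt_of_nonneg' hd hp hl]
      congr 1
      have h5 : (n:ℝ) - 2 ≠ 0 := by linarith
      have h6 : (2:ℝ) - n ≠ 0 := by linarith
      simp
      rw [← inv_neg]; congr 1; ring
    · exact integrableOn_Ioi_deriv_of_nonneg' hd hp hl
    · exact (ae_restrict_iff' measurableSet_Ioi).2 (Filter.Eventually.of_forall hp)
  · fun_prop

lemma map_proj {E : Type*} [NormedAddCommGroup E] [InnerProductSpace ℝ E] [FiniteDimensional ℝ E]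
    [MeasurableSpace E] [BorelSpace E] (U : Submodule ℝ E) :
    (stdGaussian E).map (U.orthogonalProjectionOnto) = stdGaussian U := by
  apply Measure.ext_of_charFun
  ext t
  rw [charFun_stdGaussian, charFun_apply, integral_map (by fun_prop)
    (Measurable.aestronglyMeasurable (by fun_prop))]
  have := charFun_stdGaussian (E := E) (t : E)
  rw [charFun_apply] at this
  simp_rw [Submodule.inner_orthogonalProjectionOnto_eq_of_mem_right]
  simpa using this

lemma inv_proj {N : ℕ} (U : Submodule ℝ (EuclideanSpace ℝ (Fin N))) (hU : 2 < Module.finrank ℝ U) :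
    ∫⁻ z : Fin N → ℝ, (ENNReal.ofReal (‖U.orthogonalProjectionOnto (WithLp.toLp 2 z)‖ ^ 2))⁻¹
      ∂(Measure.pi fun _ => gaussianReal 0 1) =
      ENNReal.ofReal (1 / ((Module.finrank ℝ U : ℝ) - 2)) := by
  rw [← inv_chi _ hU]
  have h1 : ∫⁻ z : Fin N → ℝ, (ENNReal.ofReal (‖U.orthogonalProjectionOnto (WithLp.toLp 2 z)‖ ^ 2))⁻¹
      ∂(Measure.pi fun _ => gaussianReal 0 1) =
      ∫⁻ u : U, (ENNReal.ofReal (‖u‖ ^ 2))⁻¹ ∂(stdGaussian U) := by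
    rw [← map_proj, lintegral_map (by fun_prop) (by fun_prop), ← map_pi_eq_stdGaussian,
      lintegral_map (by fun_prop) (by fun_prop)]
  rw [h1, stdGaussian, lintegral_map (by fun_prop) (by fun_prop)]
  refine lintegral_congr fun z => ?_
  congr 2
  have := (stdOrthonormalBasis ℝ U).repr.symm.norm_map (WithLp.toLp 2 z)
  rw [← (stdOrthonormalBasis ℝ U).sum_repr_symm] at this
  simp only at this
  rw [this, EuclideanSpace.real_norm_sq_eq]


def colv {N d : ℕ} (Z : Matrix (Fin N) (Fin d) ℝ) (j : Fin d) : EuclideanSpace ℝ (Fin N) :=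
  WithLp.toLp 2 (fun n => Z n j)

noncomputable def Usub {N d : ℕ} (Z : Matrix (Fin N) (Fin d) ℝ) (i : Fin d) :
    Submodule ℝ (EuclideanSpace ℝ (Fin N)) :=
  (Submodule.span ℝ (Set.range fun j : {j : Fin d // j ≠ i} => colv Z j))ᗮ

lemma colv_sum {N d : ℕ} (Z : Matrix (Fin N) (Fin d) ℝ) (c : Fin d → ℝ) :
    ∑ j, c j • colv Z j = WithLp.toLp 2 (Z *ᵥ c) := by
  ext n
  simp [colv, Matrix.mulVec, dotProduct, mul_comm]

lemma colv_indep {N d : ℕ} (Z : Matrix (Fin N) (Fin d) ℝ) (h : (Zᵀ * Z).det ≠ 0) :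
    LinearIndependent ℝ (colv Z) := by
  rw [Fintype.linearIndependent_iff]
  intro c hc
  rw [colv_sum] at hc
  have h1 : Z *ᵥ c = 0 := by simpa using congrArg WithLp.ofLp hc
  have h2 : (Zᵀ * Z) *ᵥ c = 0 := by rw [← Matrix.mulVec_mulVec, h1, Matrix.mulVec_zero]
  have := Matrix.eq_zero_of_mulVec_eq_zero h h2
  intro i; rw [this]; rfl

lemma finrank_U {N d : ℕ} (Z : Matrix (Fin N) (Fin d) ℝ) (h : (Zᵀ * Z).det ≠ 0) (i : Fin d) :
    Module.finrank ℝ (Usub Z i) + d = N + 1 := by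
  have h1 := (colv_indep Z h).comp (fun j : {j : Fin d // j ≠ i} => (j : Fin d))
    Subtype.val_injective
  have h2 := finrank_span_eq_card h1
  have h3 := Submodule.finrank_add_finrank_orthogonal
    (Submodule.span ℝ (Set.range fun j : {j : Fin d // j ≠ i} => colv Z j))
  have h4 : Fintype.card {j : Fin d // j ≠ i} = d - 1 := by
    simp [Fintype.card_subtype_compl]
  simp only [finrank_euclideanSpace, Fintype.card_fin] at h3
  have h5 : 0 < d := i.pos
  simp only [Function.comp_def] at h2
  unfold Usub
  omega

lemma inv_diag {N d : ℕ} (Z : Matrix (Fin N) (Fin d) ℝ) (h : (Zᵀ * Z).det ≠ 0) (i : Fin d) :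
    (Zᵀ * Z)⁻¹ i i * ‖(Usub Z i).orthogonalProjectionOnto (colv Z i)‖ ^ 2 = 1 := by
  set M := Zᵀ * Z with hM
  set c : Fin d → ℝ := M⁻¹ *ᵥ Pi.single i 1 with hc
  have hu : IsUnit M.det := isUnit_iff_ne_zero.2 h
  set p : EuclideanSpace ℝ (Fin N) := WithLp.toLp 2 (Z *ᵥ c) with hp
  have hin : ∀ j, inner ℝ (colv Z j) p = if j = i then (1:ℝ) else 0 := by
    intro j
    have : (Zᵀ *ᵥ (Z *ᵥ c)) j = if j = i then (1:ℝ) else 0 := by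
      rw [Matrix.mulVec_mulVec, ← hM, hc, Matrix.mulVec_mulVec, Matrix.mul_nonsing_inv _ hu,
        Matrix.one_mulVec, Pi.single_apply]
    rw [← this]
    simp [colv, hp, Matrix.mulVec, dotProduct, PiLp.inner_apply, mul_comm]
  have hpU : p ∈ Usub Z i := by
    unfold Usub
    rw [Submodule.mem_orthogonal]
    intro u hu
    induction hu using Submodule.span_induction with
    | mem x hx => obtain ⟨j, rfl⟩ := hx; simp [hin, j.2]
    | zero => simp
    | add x y _ _ hx hy => rw [inner_add_left, hx, hy, add_zero]
    | smul a x _ hx => rw [inner_smul_left, hx, mul_zero]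
  have hps : ∑ j, c j • colv Z j = p := colv_sum Z c
  have hci : c i = M⁻¹ i i := by simp [hc]
  have hpp : inner ℝ p p = c i := by
    nth_rewrite 1 [← hps]
    rw [sum_inner]
    simp [inner_smul_left, hin]
  set T := (Usub Z i).orthogonalProjectionOnto
  have hT : ∀ j, j ≠ i → T (colv Z j) = 0 := by
    intro j hj
    apply Submodule.orthogonalProjectionOnto_eq_zero_iff.2
    unfold Usub
    exact Submodule.le_orthogonal_orthogonal _ (Submodule.subset_span ⟨⟨j, hj⟩, rfl⟩)
  have hTp : (T p : EuclideanSpace ℝ (Fin N)) = p :=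
    Submodule.starProjection_eq_self_iff.2 hpU
  have hTp2 : T p = c i • T (colv Z i) := by
    rw [← hps, map_sum, Finset.sum_eq_single i]
    · simp
    · intro j _ hj; simp [hT j hj]
    · simp
  have hn : ‖T p‖ ^ 2 = c i := by
    rw [← hpp, real_inner_self_eq_norm_sq]
    congr 1
    rw [← hTp]; simp [hTp]
  rw [hTp2, norm_smul, mul_pow, Real.norm_eq_abs, sq_abs] at hn
  have hne : c i ≠ 0 := by
    intro h0
    have : p = 0 := by rw [h0] at hpp; exact inner_self_eq_zero.1 hpp
    have h1 := hin i
    rw [this] at h1; simp at h1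
  rw [← hci]
  apply mul_left_cancel₀ hne
  linarith


lemma pi_ac {n : ℕ} {α : Type*} [MeasurableSpace α] (μ ν : Measure α)
    [SigmaFinite μ] [SigmaFinite ν] (h : μ ≪ ν) :
    (Measure.pi fun _ : Fin n => μ) ≪ (Measure.pi fun _ : Fin n => ν) := by
  induction n with
  | zero => rw [Measure.pi_of_empty, Measure.pi_of_empty]
  | succ n ih =>
    have h1 := (measurePreserving_piFinSuccAbove (fun _ : Fin (n+1) => μ) 0).symm
    have h2 := (measurePreserving_piFinSuccAbove (fun _ : Fin (n+1) => ν) 0).symm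
    rw [← h1.map_eq, ← h2.map_eq]
    exact (h.prod ih).map (MeasurableEquiv.measurable _)

/-- standard Gaussian matrix law -/
noncomputable abbrev gm (N d : ℕ) : Measure (Fin N → Fin d → ℝ) :=
  Measure.pi fun _ => Measure.pi fun _ => gaussianReal 0 1

lemma gm_ac (N d : ℕ) : gm N d ≪ volume :=
  pi_ac _ _ (pi_ac _ _ (gaussianReal_absolutelyContinuous 0 (by simp)))

lemma det_gram_ne {N d : ℕ} (hN : d ≤ N) (Z : Matrix (Fin N) (Fin d) ℝ)
    (h : (Matrix.of fun i j : Fin d => Z (Fin.castLE hN i) j).det ≠ 0) : (Zᵀ * Z).det ≠ 0 := by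
  intro h0
  obtain ⟨c, hc, hz⟩ := Matrix.exists_mulVec_eq_zero_iff.2 h0
  apply hc
  have h1 : Z *ᵥ c = 0 := by
    have := Matrix.conjTranspose_mul_self_mulVec_eq_zero Z c
    rw [conjTranspose_eq_transpose_of_trivial] at this
    exact this.1 hz
  refine Matrix.eq_zero_of_mulVec_eq_zero h ?_
  ext i
  exact congrFun h1 (Fin.castLE hN i)

lemma gm_det {N d : ℕ} (hN : d ≤ N) :
    ∀ᵐ Z ∂(gm N d), ((Matrix.of Z)ᵀ * Matrix.of Z).det ≠ 0 := by
  let W : Fin N → Fin d → ℝ := fun n j => if n = Fin.castLE hN j then 1 else 0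
  let top : (Fin N → Fin d → ℝ) → Matrix (Fin d) (Fin d) ℝ :=
    fun Z => Matrix.of fun i j => Z (Fin.castLE hN i) j
  have key : ∀ᵐ Z ∂(volume : Measure (Fin N → Fin d → ℝ)), Z ∈ {Z | (top Z).det ≠ 0} := by
    refine ae_mem_of_ae_add_linearMap_mem (LinearMap.toSpanSingleton ℝ _ W) volume volume ?_ ?_
    · have : Continuous fun Z => (top Z).det := by
        apply Continuous.matrix_det
        fun_prop
      exact (isOpen_ne.preimage this).measurableSet
    · intro Z
      have hp : (-(top Z)).charpoly ≠ 0 := (Matrix.charpoly_monic _).ne_zero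
      have hf : {x | (-(top Z)).charpoly.IsRoot x}.Finite := Polynomial.finite_setOfPred_isRoot hp
      have := hf.measure_zero volume
      rw [ae_iff]
      refine measure_mono_null ?_ this
      intro s hs
      simp only [Set.mem_ofPred_eq, not_not, LinearMap.toSpanSingleton_apply] at hs ⊢
      rw [Polynomial.IsRoot, Matrix.eval_charpoly, ← hs]
      congr 1
      ext i j
      simp [top, W, Matrix.scalar_apply, Matrix.diagonal_apply, add_comm]
  filter_upwards [(gm_ac N d).ae_le key] with Z hZ
  exact det_gram_ne hN _ hZ

lemma mp_update {d : ℕ} (i : Fin d) (γ : Measure ℝ) [IsProbabilityMeasure γ] :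
    MeasurePreserving (fun p : (Fin d → ℝ) × ℝ => Function.update p.1 i p.2)
      ((Measure.pi fun _ => γ).prod γ) (Measure.pi fun _ => γ) := by
  refine ⟨?_, ?_⟩
  · refine measurable_pi_iff.2 fun j => ?_
    by_cases h : j = i
    · subst h; simpa using measurable_snd
    · simp only [Function.update_of_ne h]; fun_prop
  · symm
    refine Measure.pi_eq fun s hs => ?_
    rw [Measure.map_apply _ (MeasurableSet.univ_pi hs)]
    · have : (fun p : (Fin d → ℝ) × ℝ => Function.update p.1 i p.2) ⁻¹' (Set.univ.pi s) =
        (Set.univ.pi (Function.update s i Set.univ)) ×ˢ (s i) := by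
        ext ⟨x, a⟩
        simp only [Set.mem_preimage, Set.mem_univ_pi, Set.mem_prod]
        constructor
        · intro h
          refine ⟨fun j => ?_, by simpa using h i⟩
          by_cases hj : j = i
          · subst hj; simp
          · simpa [hj] using h j
        · rintro ⟨h1, h2⟩ j
          by_cases hj : j = i
          · subst hj; simpa using h2
          · simpa [hj] using h1 j
      rw [this, Measure.prod_prod, Measure.pi_pi, ← Finset.prod_erase_mul _ _ (Finset.mem_univ i),
        ← Finset.prod_erase_mul Finset.univ (fun j => γ (s j)) (Finset.mem_univ i)]
      simp only [Function.update_self, measure_univ, mul_one]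
      congr 1
      refine Finset.prod_congr rfl fun j hj => ?_
      rw [Function.update_of_ne (Finset.ne_of_mem_erase hj)]
    · refine measurable_pi_iff.2 fun j => ?_
      by_cases h : j = i
      · subst h; simpa using measurable_snd
      · simp only [Function.update_of_ne h]; fun_prop

lemma mp_updateCol {N d : ℕ} (i : Fin d) :
    MeasurePreserving (fun p : (Fin N → Fin d → ℝ) × (Fin N → ℝ) =>
      (fun n => Function.update (p.1 n) i (p.2 n)))
      ((gm N d).prod (Measure.pi fun _ => gaussianReal 0 1)) (gm N d) := by
  have h1 := (measurePreserving_arrowProdEquivProdArrow (Fin d → ℝ) ℝ (Fin N)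
    (fun _ => Measure.pi fun _ => gaussianReal 0 1) (fun _ => gaussianReal 0 1)).symm
  have h2 := measurePreserving_pi (ι := Fin N) _ _ (fun _ => mp_update i (gaussianReal 0 1))
  exact h2.comp h1

lemma mp_sign {N d : ℕ} (i : Fin d) :
    MeasurePreserving (fun (Z : Fin N → Fin d → ℝ) n j => if j = i then - Z n j else Z n j)
      (gm N d) (gm N d) := by
  have h : MeasurePreserving (fun x : ℝ => -x) (gaussianReal 0 1) (gaussianReal 0 1) :=
    ⟨by fun_prop, by simp [gaussianReal_map_neg]⟩
  refine measurePreserving_pi (ι := Fin N) (f := fun _ (x : Fin d → ℝ) j => if j = i then - x j else x j) _ _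
    (fun _ => ?_)
  refine measurePreserving_pi (ι := Fin d) (f := fun j (x : ℝ) => if j = i then - x else x) _ _
    (fun j => ?_)
  by_cases hj : j = i
  · simpa [hj] using h
  · simp only [hj, if_false]; exact MeasurePreserving.id _


lemma inv_apply_eq {d : ℕ} (M : Matrix (Fin d) (Fin d) ℝ) (i j : Fin d) :
    M⁻¹ i j = (M.det)⁻¹ * M.adjugate i j := by
  rw [Matrix.inv_def, Ring.inverse_eq_inv']; rfl

lemma meas_inv {N d : ℕ} (i j : Fin d) :
    Measurable fun Z : Fin N → Fin d → ℝ => (((Matrix.of Z)ᵀ * Matrix.of Z)⁻¹) i j := by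
  simp_rw [inv_apply_eq]
  have hc : Continuous fun Z : Fin N → Fin d → ℝ => ((Matrix.of Z)ᵀ * Matrix.of Z) := by
    have : Continuous fun Z : Fin N → Fin d → ℝ => (Matrix.of Z) := continuous_id
    exact this.matrix_transpose.matrix_mul this
  exact hc.matrix_det.measurable.inv.mul
    ((hc.matrix_adjugate.matrix_elem i j).measurable)

lemma meas_pinv {N d : ℕ} (i : Fin d) (n : Fin N) :
    Measurable fun Z : Fin N → Fin d → ℝ => pinv (Matrix.of Z) i n := by
  simp only [pinv, Matrix.mul_apply]
  refine Finset.measurable_sum _ fun j _ => (meas_inv i j).mul ?_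
  simp only [Matrix.transpose_apply, Matrix.of_apply]
  fun_prop

lemma lint_diag {N d : ℕ} (hN : d + 1 < N) (i : Fin d) :
    ∫⁻ Z, ENNReal.ofReal ((((Matrix.of Z)ᵀ * Matrix.of Z)⁻¹) i i) ∂(gm N d) =
      ENNReal.ofReal (1 / ((N : ℝ) - d - 1)) := by
  have hmp := mp_updateCol (N := N) i
  rw [← hmp.lintegral_comp (meas_inv i i).ennreal_ofReal, lintegral_prod]
  swap
  · exact ((meas_inv i i).ennreal_ofReal.comp hmp.measurable).aemeasurable
  have hdet := gm_det (N := N) (d := d) (by omega)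
  have hdet2 := hmp.quasiMeasurePreserving.ae hdet
  have hdet3 := Measure.ae_ae_of_ae_prod hdet2
  have hin : ∀ᵐ Z ∂(gm N d), ∫⁻ z : Fin N → ℝ, ENNReal.ofReal
      ((((Matrix.of (fun n => Function.update (Z n) i (z n)))ᵀ *
        Matrix.of (fun n => Function.update (Z n) i (z n)))⁻¹) i i)
        ∂(Measure.pi fun _ => gaussianReal 0 1) = ENNReal.ofReal (1 / ((N : ℝ) - d - 1)) := by
    filter_upwards [hdet, hdet3] with Z hZ hZ3
    have hr := finrank_U (Matrix.of Z) hZ i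
    have hr' : (Module.finrank ℝ (Usub (Matrix.of Z) i) : ℝ) + d = N + 1 := by exact_mod_cast hr
    have : (N : ℝ) - d - 1 = (Module.finrank ℝ (Usub (Matrix.of Z) i) : ℝ) - 2 := by linarith
    rw [this, ← inv_proj _ (by omega)]
    refine lintegral_congr_ae ?_
    filter_upwards [hZ3] with z hz
    have h1 := inv_diag (Matrix.of (fun n => Function.update (Z n) i (z n))) hz i
    have hU : Usub (Matrix.of (fun n => Function.update (Z n) i (z n))) i = Usub (Matrix.of Z) i := by
      unfold Usub
      congr 3
      ext j
      simp [colv, Function.update_of_ne j.2]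
    have hcol : colv (Matrix.of (fun n => Function.update (Z n) i (z n))) i = WithLp.toLp 2 z := by
      simp [colv]
    rw [hU, hcol] at h1
    have h2 := eq_inv_of_mul_eq_one_left h1
    rw [h2, ENNReal.ofReal_inv_of_pos]
    refine lt_of_le_of_ne (by positivity) fun h => ?_
    rw [← h] at h1; simp at h1
  rw [lintegral_congr_ae hin]
  simp

lemma pinv_mul_self {N d : ℕ} (Z : Matrix (Fin N) (Fin d) ℝ) (h : (Zᵀ * Z).det ≠ 0) :
    pinv Z * Z = 1 := by
  rw [pinv, Matrix.mul_assoc, Matrix.nonsing_inv_mul _ (isUnit_iff_ne_zero.2 h)]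

lemma pinv_mul_tr {N d : ℕ} (Z : Matrix (Fin N) (Fin d) ℝ) (h : (Zᵀ * Z).det ≠ 0) :
    pinv Z * (pinv Z)ᵀ = (Zᵀ * Z)⁻¹ := by
  have : (pinv Z)ᵀ = Z * (Zᵀ * Z)⁻¹ := by
    rw [pinv, Matrix.transpose_mul, Matrix.transpose_transpose, Matrix.transpose_nonsing_inv,
      Matrix.transpose_mul, Matrix.transpose_transpose]
  rw [this, ← Matrix.mul_assoc, pinv_mul_self Z h, Matrix.one_mul]


lemma memLp_pinv {N d : ℕ} (hN : d + 1 < N) (i : Fin d) (n : Fin N) :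
    MemLp (fun Z : Fin N → Fin d → ℝ => pinv (Matrix.of Z) i n) 2 (gm N d) := by
  rw [memLp_two_iff_integrable_sq (meas_pinv i n).aestronglyMeasurable]
  refine ⟨((meas_pinv i n).pow_const 2).aestronglyMeasurable, ?_⟩
  rw [hasFiniteIntegral_iff_ofReal (Filter.Eventually.of_forall fun Z => sq_nonneg _)]
  refine lt_of_le_of_lt ?_ (lt_of_eq_of_lt (lint_diag hN i) ENNReal.ofReal_lt_top)
  refine lintegral_mono_ae ?_
  filter_upwards [gm_det (N := N) (d := d) (by omega)] with Z hZ
  refine ENNReal.ofReal_le_ofReal ?_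
  rw [← pinv_mul_tr _ hZ, Matrix.mul_apply]
  simp only [Matrix.transpose_apply, ← sq]
  exact Finset.single_le_sum (f := fun n => pinv (Matrix.of Z) i n ^ 2)
    (fun n _ => sq_nonneg _) (Finset.mem_univ n)

lemma pinv_flip {N d : ℕ} (i k : Fin d) (n : Fin N) (Z : Matrix (Fin N) (Fin d) ℝ) :
    pinv (Matrix.of fun n j => if j = i then - Z n j else Z n j) k n =
      if k = i then - pinv Z k n else pinv Z k n := by
  set D : Matrix (Fin d) (Fin d) ℝ := Matrix.diagonal fun j => if j = i then -1 else 1 with hD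
  have hDD : D * D = 1 := by
    rw [hD, Matrix.diagonal_mul_diagonal, ← Matrix.diagonal_one]
    congr 1; ext j; split_ifs <;> norm_num
  have hDi : D⁻¹ = D := Matrix.inv_eq_left_inv hDD
  have hDt : Dᵀ = D := Matrix.diagonal_transpose _
  have h1 : (Matrix.of fun n j => if j = i then - Z n j else Z n j) = Z * D := by
    ext n j
    rw [hD, Matrix.mul_diagonal]
    simp only [Matrix.of_apply]; split_ifs <;> simp
  have h2 : pinv (Z * D) = D * pinv Z := by
    unfold pinv
    rw [Matrix.transpose_mul, hDt]
    have : D * Zᵀ * (Z * D) = D * (Zᵀ * Z) * D := by simp only [Matrix.mul_assoc]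
    rw [this, Matrix.mul_inv_rev, Matrix.mul_inv_rev, hDi]
    calc _ = D * ((Zᵀ * Z)⁻¹ * ((D * D) * Zᵀ)) := by simp only [Matrix.mul_assoc]
      _ = _ := by rw [hDD, Matrix.one_mul]
  rw [h1, h2, hD, Matrix.diagonal_mul]
  split_ifs <;> simp

lemma integrable_pp {N d : ℕ} (hN : d + 1 < N) (i j : Fin d) (n m : Fin N) :
    Integrable (fun Z : Fin N → Fin d → ℝ => pinv (Matrix.of Z) i n * pinv (Matrix.of Z) j m)
      (gm N d) := (memLp_pinv hN i n).integrable_mul (memLp_pinv hN j m)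

lemma int_pp {N d : ℕ} (hN : d + 1 < N) (i j : Fin d) :
    ∑ n, ∫ Z, pinv (Matrix.of Z) i n * pinv (Matrix.of Z) j n ∂(gm N d) =
      if i = j then 1 / ((N : ℝ) - d - 1) else 0 := by
  split_ifs with hij
  · subst hij
    have hpos : 0 ≤ 1 / ((N : ℝ) - d - 1) := by
      have : (d : ℝ) + 1 < N := by exact_mod_cast hN
      apply one_div_nonneg.2; linarith
    rw [← integral_finsetSum _ fun n _ => integrable_pp hN i i n n,
      integral_eq_lintegral_of_nonneg_ae, ← ENNReal.toReal_ofReal hpos, ← lint_diag hN i]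
    · congr 1
      refine lintegral_congr_ae ?_
      filter_upwards [gm_det (N := N) (d := d) (by omega)] with Z hZ
      rw [← pinv_mul_tr _ hZ, Matrix.mul_apply]; rfl
    · exact Filter.Eventually.of_forall fun Z => Finset.sum_nonneg fun n _ => mul_self_nonneg _
    · exact (integrable_finsetSum _ fun n _ => integrable_pp hN i i n n).aestronglyMeasurable
  · refine Finset.sum_eq_zero fun n _ => ?_
    have hmp := mp_sign (N := N) i
    have h := integral_map (μ := gm N d) hmp.measurable.aemeasurable
      (f := fun Z : Fin N → Fin d → ℝ => pinv (Matrix.of Z) i n * pinv (Matrix.of Z) j n)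
      ((meas_pinv i n).mul (meas_pinv j n)).aestronglyMeasurable
    rw [hmp.map_eq] at h
    have h3 : ∀ Z : Fin N → Fin d → ℝ,
        pinv (Matrix.of fun n j => if j = i then - Z n j else Z n j) i n *
        pinv (Matrix.of fun n j => if j = i then - Z n j else Z n j) j n =
        - (pinv (Matrix.of Z) i n * pinv (Matrix.of Z) j n) := by
      intro Z
      have e1 := pinv_flip i i n (Matrix.of Z)
      have e2 := pinv_flip i j n (Matrix.of Z)
      simp only [Matrix.of_apply] at e1 e2
      rw [e1, e2, if_pos trivial, if_neg (Ne.symm hij)]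
      ring
    simp_rw [h3] at h
    rw [integral_neg] at h
    linarith

/-- abstract second moment lemma -/
lemma prod_moments {N d : ℕ} {Ω Ω' : Type*} [MeasurableSpace Ω] [MeasurableSpace Ω']
    (μ : Measure Ω) (ρ : Measure Ω') [IsProbabilityMeasure μ] [IsProbabilityMeasure ρ]
    (p : Ω → Matrix (Fin d) (Fin N) ℝ) (e : Ω' → Fin N → ℝ) (s : ℝ)
    (hp : ∀ i n, MemLp (fun z => p z i n) 2 μ) (he : ∀ n, MemLp (fun w => e w n) 2 ρ)
    (he0 : ∀ n, ∫ w, e w n ∂ρ = 0)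
    (hee : ∀ n m, ∫ w, e w n * e w m ∂ρ = if n = m then s else 0) :
    (∀ i, Integrable (fun ω : Ω × Ω' => (p ω.1 *ᵥ e ω.2) i) (μ.prod ρ)) ∧
    (∀ i, ∫ ω, (p ω.1 *ᵥ e ω.2) i ∂(μ.prod ρ) = 0) ∧
    (∀ i j, Integrable (fun ω : Ω × Ω' => (p ω.1 *ᵥ e ω.2) i * (p ω.1 *ᵥ e ω.2) j) (μ.prod ρ)) ∧
    (∀ i j, ∫ ω, (p ω.1 *ᵥ e ω.2) i * (p ω.1 *ᵥ e ω.2) j ∂(μ.prod ρ) =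
      s * ∑ n, ∫ z, p z i n * p z j n ∂μ) := by
  have hx : ∀ (ω : Ω × Ω') i j, (p ω.1 *ᵥ e ω.2) i * (p ω.1 *ᵥ e ω.2) j =
      ∑ n, ∑ m, (p ω.1 i n * p ω.1 j m) * (e ω.2 n * e ω.2 m) := by
    intro ω i j
    simp only [Matrix.mulVec, dotProduct, Finset.sum_mul_sum]
    exact Finset.sum_congr rfl fun n _ => Finset.sum_congr rfl fun m _ => by ring
  have hi1 : ∀ i n, Integrable (fun ω : Ω × Ω' => p ω.1 i n * e ω.2 n) (μ.prod ρ) := fun i n =>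
    ((hp i n).integrable (by norm_num)).mul_prod ((he n).integrable (by norm_num))
  have hi2 : ∀ i j n m, Integrable
      (fun ω : Ω × Ω' => (p ω.1 i n * p ω.1 j m) * (e ω.2 n * e ω.2 m)) (μ.prod ρ) :=
    fun i j n m => ((hp i n).integrable_mul (hp j m)).mul_prod ((he n).integrable_mul (he m))
  refine ⟨fun i => ?_, fun i => ?_, fun i j => ?_, fun i j => ?_⟩
  · simp only [Matrix.mulVec, dotProduct]
    exact integrable_finsetSum _ fun n _ => hi1 i n
  · simp only [Matrix.mulVec, dotProduct]
    rw [integral_finsetSum _ fun n _ => hi1 i n]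
    refine Finset.sum_eq_zero fun n _ => ?_
    rw [integral_prod_mul (fun z => p z i n) (fun w => e w n), he0, mul_zero]
  · simp_rw [hx]
    exact integrable_finsetSum _ fun n _ => integrable_finsetSum _ fun m _ => hi2 i j n m
  · simp_rw [hx]
    rw [integral_finsetSum _ fun n _ => integrable_finsetSum _ fun m _ => hi2 i j n m,
      Finset.mul_sum]
    refine Finset.sum_congr rfl fun n _ => ?_
    rw [integral_finsetSum _ fun m _ => hi2 i j n m]
    simp_rw [fun m => integral_prod_mul (μ := μ) (ν := ρ) (fun z => p z i n * p z j m)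
      (fun w => e w n * e w m), hee]
    simp [mul_comm]

instance gv_prob (n : ℕ) (v : ℝ) : IsProbabilityMeasure (gaussianVec n v) := by
  unfold gaussianVec; infer_instance

lemma gv_memLp (n : ℕ) (v : ℝ) (a : Fin n) :
    MemLp (fun x : Fin n → ℝ => x a) 2 (gaussianVec n v) := by
  have h := measurePreserving_eval (fun _ : Fin n => gaussianReal 0 (Real.toNNReal v)) a
  exact MemLp.comp_measurePreserving (g := fun x : ℝ => x) (memLp_id_gaussianReal 2) h

lemma gv_mean (n : ℕ) (v : ℝ) (a : Fin n) : ∫ x, x a ∂(gaussianVec n v) = 0 := by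
  have h := integral_comp_eval (μ := fun _ : Fin n => gaussianReal 0 (Real.toNNReal v)) (i := a)
    (f := fun x : ℝ => x) (by fun_prop)
  simpa [gaussianVec] using h

lemma gv_cov (n : ℕ) (v : ℝ) (hv : 0 ≤ v) (a b : Fin n) :
    ∫ x, x a * x b ∂(gaussianVec n v) = if a = b then v else 0 := by
  split_ifs with hab
  · subst hab
    have h := integral_comp_eval (μ := fun _ : Fin n => gaussianReal 0 (Real.toNNReal v)) (i := a)
      (f := fun x : ℝ => x * x) (by fun_prop)
    have h2 := variance_fun_id_gaussianReal (μ := 0) (v := Real.toNNReal v)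
    rw [variance_eq_integral (by fun_prop)] at h2
    simp only [integral_id_gaussianReal, sub_zero, Real.coe_toNNReal _ hv] at h2
    rw [gaussianVec, h]
    simp only [sq] at h2
    exact h2
  · have h := (iIndepFun_pi (μ := fun _ : Fin n => gaussianReal 0 (Real.toNNReal v))
      (X := fun _ x => x) (fun _ => by fun_prop)).indepFun hab
    have h2 := h.integral_fun_mul_eq_mul_integral
      (gv_memLp n v a).aestronglyMeasurable (gv_memLp n v b).aestronglyMeasurable
    have h3 := gv_mean n v a
    rw [gaussianVec] at h3 ⊢
    rw [h2, h3, zero_mul]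

/-- aux noise law -/
noncomputable abbrev auxn (N K : ℕ) (σa : Fin K → ℝ) : Measure (Fin K → Fin N → ℝ) :=
  Measure.pi fun k : Fin K => gaussianVec N (σa k ^ 2)

lemma aux_memLp (N K : ℕ) (σa : Fin K → ℝ) (k : Fin K) (n : Fin N) :
    MemLp (fun x : Fin K → Fin N → ℝ => x k n) 2 (auxn N K σa) :=
  MemLp.comp_measurePreserving (g := fun x : Fin N → ℝ => x n) (gv_memLp N _ n)
    (measurePreserving_eval (fun k => gaussianVec N (σa k ^ 2)) k)

lemma aux_mean (N K : ℕ) (σa : Fin K → ℝ) (k : Fin K) (n : Fin N) :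
    ∫ x, x k n ∂(auxn N K σa) = 0 := by
  rw [integral_comp_eval (μ := fun k => gaussianVec N (σa k ^ 2)) (i := k)
    (f := fun x : Fin N → ℝ => x n) (measurable_pi_apply n).aestronglyMeasurable, gv_mean]

lemma aux_cov (N K : ℕ) (σa : Fin K → ℝ) (k l : Fin K) (n m : Fin N) :
    ∫ x, x k n * x l m ∂(auxn N K σa) = if k = l then (if n = m then σa k ^ 2 else 0) else 0 := by
  split_ifs with hkl hnm
  · subst hkl
    rw [integral_comp_eval (μ := fun k => gaussianVec N (σa k ^ 2)) (i := k)
      (f := fun x : Fin N → ℝ => x n * x m) (by fun_prop), gv_cov _ _ (sq_nonneg _), if_pos hnm]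
  · subst hkl
    rw [integral_comp_eval (μ := fun k => gaussianVec N (σa k ^ 2)) (i := k)
      (f := fun x : Fin N → ℝ => x n * x m) (by fun_prop), gv_cov _ _ (sq_nonneg _), if_neg hnm]
  · have h := (iIndepFun_pi (μ := fun k => gaussianVec N (σa k ^ 2))
      (X := fun _ x => x) (fun _ => by fun_prop)).indepFun hkl
    have h' := h.comp (measurable_pi_apply n) (measurable_pi_apply m)
    have h2 := h'.integral_fun_mul_eq_mul_integral
      (aux_memLp N K σa k n).aestronglyMeasurable (aux_memLp N K σa l m).aestronglyMeasurable
    have h3 := aux_mean N K σa k n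
    simp only [Function.comp_def] at h2
    rw [h2, h3, zero_mul]

/-- combined noise -/
def noise {N K : ℕ} (lam : Fin K → ℝ) (w : (Fin K → Fin N → ℝ) × (Fin N → ℝ)) : Fin N → ℝ :=
  w.2 + ∑ k, lam k • w.1 k

/-- noise law -/
noncomputable abbrev nlaw (N K : ℕ) (σm : ℝ) (σa : Fin K → ℝ) :
    Measure ((Fin K → Fin N → ℝ) × (Fin N → ℝ)) :=
  (auxn N K σa).prod (gaussianVec N (σm ^ 2))

/-- aux part -/
def noiseA {N K : ℕ} (lam : Fin K → ℝ) (w : Fin K → Fin N → ℝ) : Fin N → ℝ :=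
  ∑ k, lam k • w k

lemma noiseA_apply {N K : ℕ} (lam : Fin K → ℝ) (w : Fin K → Fin N → ℝ) (n : Fin N) :
    noiseA lam w n = ∑ k, lam k * w k n := by
  simp [noiseA]

lemma noiseA_memLp (N K : ℕ) (lam : Fin K → ℝ) (σa : Fin K → ℝ) (n : Fin N) :
    MemLp (fun w => noiseA lam w n) 2 (auxn N K σa) := by
  simp_rw [noiseA_apply]
  exact memLp_finsetSum _ fun k _ => (aux_memLp N K σa k n).const_mul _

lemma noiseA_mean (N K : ℕ) (lam : Fin K → ℝ) (σa : Fin K → ℝ) (n : Fin N) :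
    ∫ w, noiseA lam w n ∂(auxn N K σa) = 0 := by
  simp_rw [noiseA_apply]
  rw [integral_finsetSum _ fun k _ =>
    ((aux_memLp N K σa k n).integrable (by norm_num)).const_mul _]
  refine Finset.sum_eq_zero fun k _ => ?_
  rw [integral_const_mul, aux_mean, mul_zero]

lemma noiseA_cov (N K : ℕ) (lam : Fin K → ℝ) (σa : Fin K → ℝ) (n m : Fin N) :
    ∫ w, noiseA lam w n * noiseA lam w m ∂(auxn N K σa) =
      if n = m then ∑ k, lam k ^ 2 * σa k ^ 2 else 0 := by
  simp_rw [noiseA_apply, Finset.sum_mul_sum]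
  have hi : ∀ k l, Integrable (fun w : Fin K → Fin N → ℝ => lam k * w k n * (lam l * w l m))
      (auxn N K σa) := fun k l =>
    ((aux_memLp N K σa k n).const_mul (lam k)).integrable_mul
      ((aux_memLp N K σa l m).const_mul (lam l))
  rw [integral_finsetSum _ fun k _ => integrable_finsetSum _ fun l _ => hi k l]
  have : ∀ k, ∫ w : Fin K → Fin N → ℝ, ∑ l, lam k * w k n * (lam l * w l m) ∂(auxn N K σa) =
      if n = m then lam k ^ 2 * σa k ^ 2 else 0 := by
    intro k
    rw [integral_finsetSum _ fun l _ => hi k l, Finset.sum_eq_single k]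
    · have : ∀ w : Fin K → Fin N → ℝ, lam k * w k n * (lam k * w k m) =
        lam k ^ 2 * (w k n * w k m) := fun w => by ring
      simp_rw [this]
      rw [integral_const_mul, aux_cov, if_pos rfl]
      split_ifs <;> simp
    · intro l _ hl
      have : ∀ w : Fin K → Fin N → ℝ, lam k * w k n * (lam l * w l m) =
        (lam k * lam l) * (w k n * w l m) := fun w => by ring
      simp_rw [this]
      rw [integral_const_mul, aux_cov, if_neg (Ne.symm hl), mul_zero]
    · simp
  simp_rw [this]
  split_ifs <;> simp

lemma noise_apply {N K : ℕ} (lam : Fin K → ℝ) (w : (Fin K → Fin N → ℝ) × (Fin N → ℝ)) (n : Fin N) :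
    noise lam w n = w.2 n + noiseA lam w.1 n := rfl

lemma noise_memLp (N K : ℕ) (lam : Fin K → ℝ) (σm : ℝ) (σa : Fin K → ℝ) (n : Fin N) :
    MemLp (fun w => noise lam w n) 2 (nlaw N K σm σa) := by
  simp_rw [noise_apply]
  exact (MemLp.comp_measurePreserving (g := fun x : Fin N → ℝ => x n) (gv_memLp N _ n)
    measurePreserving_snd).add (MemLp.comp_measurePreserving
      (g := fun w => noiseA lam w n) (noiseA_memLp N K lam σa n) measurePreserving_fst)

lemma noise_mean (N K : ℕ) (lam : Fin K → ℝ) (σm : ℝ) (σa : Fin K → ℝ) (n : Fin N) :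
    ∫ w, noise lam w n ∂(nlaw N K σm σa) = 0 := by
  simp_rw [noise_apply]
  rw [integral_add]
  · rw [integral_fun_snd (fun x : Fin N → ℝ => x n), integral_fun_fst (fun w => noiseA lam w n),
      gv_mean, noiseA_mean]; simp
  · exact ((gv_memLp N _ n).integrable (by norm_num)).comp_snd _
  · exact ((noiseA_memLp N K lam σa n).integrable (by norm_num)).comp_fst _

lemma noise_cov (N K : ℕ) (lam : Fin K → ℝ) (σm : ℝ) (σa : Fin K → ℝ) (n m : Fin N) :
    ∫ w, noise lam w n * noise lam w m ∂(nlaw N K σm σa) =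
      if n = m then σm ^ 2 + ∑ k, lam k ^ 2 * σa k ^ 2 else 0 := by
  simp_rw [noise_apply]
  have e : ∀ w : (Fin K → Fin N → ℝ) × (Fin N → ℝ),
    (w.2 n + noiseA lam w.1 n) * (w.2 m + noiseA lam w.1 m) =
    (w.2 n * w.2 m + noiseA lam w.1 n * noiseA lam w.1 m) +
      (noiseA lam w.1 m * w.2 n + noiseA lam w.1 n * w.2 m) := fun w => by ring
  simp_rw [e]
  have i1 : Integrable (fun w : (Fin K → Fin N → ℝ) × (Fin N → ℝ) => w.2 n * w.2 m)
      (nlaw N K σm σa) := ((gv_memLp N _ n).integrable_mul (gv_memLp N _ m)).comp_snd _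
  have i2 : Integrable (fun w : (Fin K → Fin N → ℝ) × (Fin N → ℝ) =>
      noiseA lam w.1 n * noiseA lam w.1 m) (nlaw N K σm σa) :=
    ((noiseA_memLp N K lam σa n).integrable_mul (noiseA_memLp N K lam σa m)).comp_fst _
  have i3 : ∀ n m, Integrable (fun w : (Fin K → Fin N → ℝ) × (Fin N → ℝ) =>
      noiseA lam w.1 n * w.2 m) (nlaw N K σm σa) := fun n m =>
    ((noiseA_memLp N K lam σa n).integrable (by norm_num)).mul_prod
      ((gv_memLp N _ m).integrable (by norm_num))
  have i12 : Integrable (fun w : (Fin K → Fin N → ℝ) × (Fin N → ℝ) =>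
    w.2 n * w.2 m + noiseA lam w.1 n * noiseA lam w.1 m) (nlaw N K σm σa) := i1.add i2
  have i33 : Integrable (fun w : (Fin K → Fin N → ℝ) × (Fin N → ℝ) =>
    noiseA lam w.1 m * w.2 n + noiseA lam w.1 n * w.2 m) (nlaw N K σm σa) := (i3 m n).add (i3 n m)
  rw [integral_add i12 i33, integral_add i1 i2,
    integral_add (i3 m n) (i3 n m),
    integral_fun_snd (fun x : Fin N → ℝ => x n * x m),
    integral_fun_fst (fun w => noiseA lam w n * noiseA lam w m),
    integral_prod_mul (fun w => noiseA lam w m) (fun x : Fin N → ℝ => x n),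
    integral_prod_mul (fun w => noiseA lam w n) (fun x : Fin N → ℝ => x m),
    noiseA_mean, noiseA_mean, gv_cov _ _ (sq_nonneg _), noiseA_cov]
  split_ifs <;> simp

lemma P_eq (N d K : ℕ) (σm : ℝ) (σa : Fin K → ℝ) :
    P N d K σm σa = (gm N d).prod (nlaw N K σm σa) := by
  simp [P, gaussianVec, gm, nlaw, auxn]

lemma pinv_X {N d : ℕ} (Z : Matrix (Fin N) (Fin d) ℝ) (A : Matrix (Fin d) (Fin d) ℝ)
    (hA : IsUnit A.det) : pinv (Z * Aᵀ) = (A⁻¹)ᵀ * pinv Z := by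
  unfold pinv
  rw [Matrix.transpose_mul, Matrix.transpose_transpose]
  have : A * Zᵀ * (Z * Aᵀ) = A * (Zᵀ * Z) * Aᵀ := by simp only [Matrix.mul_assoc]
  rw [this, Matrix.mul_inv_rev, Matrix.mul_inv_rev, ← Matrix.transpose_nonsing_inv]
  calc _ = (A⁻¹)ᵀ * ((Zᵀ * Z)⁻¹ * ((A⁻¹ * A) * Zᵀ)) := by simp only [Matrix.mul_assoc]
    _ = _ := by rw [Matrix.nonsing_inv_mul _ hA, Matrix.one_mul]

lemma wHat_eq {N d K : ℕ} (A : Matrix (Fin d) (Fin d) ℝ) (hA : IsUnit A.det) (wm : Fin d → ℝ)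
    (wk : Fin K → Fin d → ℝ) (lam : Fin K → ℝ) (ω : Sample N d K)
    (h : ((Matrix.of ω.1)ᵀ * Matrix.of ω.1).det ≠ 0) :
    wHat A wm wk lam ω = (1 / (1 + ∑ k, lam k)) • (wm + ∑ k, lam k • wk k) +
      (1 / (1 + ∑ k, lam k)) • (((A⁻¹)ᵀ * pinv (Matrix.of ω.1)) *ᵥ noise lam ω.2) := by
  have h1 : ((A⁻¹)ᵀ * pinv (Matrix.of ω.1)) * (Matrix.of ω.1 * Aᵀ) = 1 := by
    calc _ = (A⁻¹)ᵀ * ((pinv (Matrix.of ω.1) * Matrix.of ω.1) * Aᵀ) := by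
          simp only [Matrix.mul_assoc]
      _ = _ := by rw [pinv_mul_self _ h, Matrix.one_mul, ← Matrix.transpose_mul,
                    Matrix.mul_nonsing_inv _ hA, Matrix.transpose_one]
  unfold wHat Ym Ya Xmat noise
  rw [pinv_X _ _ hA]
  simp only [Matrix.mulVec_add, Matrix.mulVec_mulVec, h1, Matrix.one_mulVec, smul_add,
    Finset.sum_add_distrib, Matrix.mulVec_sum, Matrix.mulVec_smul]
  abel

lemma delta_moments (N d K : ℕ) (hN : d + 1 < N)
    (Sigx : Matrix (Fin d) (Fin d) ℝ)
    (A : Matrix (Fin d) (Fin d) ℝ) (hA : A * Aᵀ = Sigx) (hAu : IsUnit A.det)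
    (wm : Fin d → ℝ) (wk : Fin K → Fin d → ℝ)
    (σm : ℝ) (σa : Fin K → ℝ) (lam : Fin K → ℝ) (i j : Fin d) :
    Integrable (fun ω => (wHat A wm wk lam ω i - wBar N d K A wm wk lam σm σa i) *
          (wHat A wm wk lam ω j - wBar N d K A wm wk lam σm σa j)) (P N d K σm σa) ∧
    ∫ ω, (wHat A wm wk lam ω i - wBar N d K A wm wk lam σm σa i) *
          (wHat A wm wk lam ω j - wBar N d K A wm wk lam σm σa j) ∂(P N d K σm σa) =
        ((1 / (1 + ∑ k, lam k)) ^ 2 * (σm ^ 2 + ∑ k, lam k ^ 2 * σa k ^ 2) *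
          (1 / ((N : ℝ) - (d : ℝ) - 1))) * Sigx⁻¹ i j := by
  set c : ℝ := 1 / (1 + ∑ k, lam k) with hc
  set s : ℝ := σm ^ 2 + ∑ k, lam k ^ 2 * σa k ^ 2 with hs
  set B : Matrix (Fin d) (Fin d) ℝ := (A⁻¹)ᵀ with hB
  set p : (Fin N → Fin d → ℝ) → Matrix (Fin d) (Fin N) ℝ := fun Z => B * pinv (Matrix.of Z) with hp
  have hpL : ∀ i n, MemLp (fun z => p z i n) 2 (gm N d) := by
    intro i n
    simp only [hp, Matrix.mul_apply]
    exact memLp_finsetSum _ fun a _ => (memLp_pinv hN a n).const_mul _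
  obtain ⟨m1, m2, m3, m4⟩ := prod_moments (gm N d) (nlaw N K σm σa) p (noise lam) s hpL
    (noise_memLp N K lam σm σa) (noise_mean N K lam σm σa) (noise_cov N K lam σm σa)
  have hae : ∀ᵐ ω ∂((gm N d).prod (nlaw N K σm σa)), ∀ i, wHat A wm wk lam ω i =
      (c • (wm + ∑ k, lam k • wk k)) i + c * (p ω.1 *ᵥ noise lam ω.2) i := by
    have h1 := Measure.quasiMeasurePreserving_fst (μ := gm N d) (ν := nlaw N K σm σa) |>.ae
      (gm_det (N := N) (d := d) (by omega))
    filter_upwards [h1] with ω hω i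
    rw [wHat_eq A hAu wm wk lam ω hω]
    rfl
  have hbar : ∀ i, wBar N d K A wm wk lam σm σa i = (c • (wm + ∑ k, lam k • wk k)) i := by
    intro i
    unfold wBar
    rw [P_eq, integral_congr_ae (hae.mono fun ω h => h i),
      integral_add (integrable_const _) ((m1 i).const_mul c), integral_const_mul, m2]
    simp
  have hae2 : ∀ᵐ ω ∂((gm N d).prod (nlaw N K σm σa)),
      (wHat A wm wk lam ω i - wBar N d K A wm wk lam σm σa i) *
          (wHat A wm wk lam ω j - wBar N d K A wm wk lam σm σa j) =
      c ^ 2 * ((p ω.1 *ᵥ noise lam ω.2) i * (p ω.1 *ᵥ noise lam ω.2) j) := by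
    filter_upwards [hae] with ω h
    rw [h i, h j, hbar, hbar]; ring
  have hpp : ∑ n, ∫ z, p z i n * p z j n ∂(gm N d) = 1 / ((N : ℝ) - d - 1) * Sigx⁻¹ i j := by
    have hS : Sigx⁻¹ = B * Bᵀ := by
      rw [← hA, Matrix.mul_inv_rev, hB, Matrix.transpose_transpose, Matrix.transpose_nonsing_inv]
    have e : ∀ z n, p z i n * p z j n =
        ∑ a, ∑ b, (B i a * B j b) * (pinv (Matrix.of z) a n * pinv (Matrix.of z) b n) := by
      intro z n
      simp only [hp, Matrix.mul_apply, Finset.sum_mul_sum]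
      exact Finset.sum_congr rfl fun a _ => Finset.sum_congr rfl fun b _ => by ring
    have hI : ∀ n a b, Integrable (fun z : Fin N → Fin d → ℝ =>
        (B i a * B j b) * (pinv (Matrix.of z) a n * pinv (Matrix.of z) b n)) (gm N d) :=
      fun n a b => (integrable_pp hN a b n n).const_mul _
    have e2 : ∀ n, ∫ z, p z i n * p z j n ∂(gm N d) = ∑ a, ∑ b, (B i a * B j b) *
        ∫ z, pinv (Matrix.of z) a n * pinv (Matrix.of z) b n ∂(gm N d) := by
      intro n
      simp_rw [e]
      rw [integral_finsetSum _ fun a _ => integrable_finsetSum _ fun b _ => hI n a b]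
      refine Finset.sum_congr rfl fun a _ => ?_
      rw [integral_finsetSum _ fun b _ => hI n a b]
      refine Finset.sum_congr rfl fun b _ => ?_
      rw [integral_const_mul]
    simp_rw [e2]
    rw [Finset.sum_comm]
    simp_rw [Finset.sum_comm (s := (Finset.univ : Finset (Fin N))), ← Finset.mul_sum, int_pp hN]
    rw [hS, Matrix.mul_apply, Finset.mul_sum]
    simp [mul_comm, mul_left_comm]
  rw [P_eq]
  refine ⟨((m3 i j).const_mul (c ^ 2)).congr (hae2.mono fun ω h => h.symm), ?_⟩
  rw [integral_congr_ae hae2, integral_const_mul, m4, hpp]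
  ring

lemma g_moments {d : ℕ} (A : Matrix (Fin d) (Fin d) ℝ) (i j : Fin d) :
    Integrable (fun g => (A *ᵥ g) i * (A *ᵥ g) j) (gaussianVec d 1) ∧
    ∫ g, (A *ᵥ g) i * (A *ᵥ g) j ∂(gaussianVec d 1) = (A * Aᵀ) i j := by
  have e : ∀ g : Fin d → ℝ, (A *ᵥ g) i * (A *ᵥ g) j = ∑ a, ∑ b, (A i a * A j b) * (g a * g b) := by
    intro g
    simp only [Matrix.mulVec, dotProduct, Finset.sum_mul_sum]
    exact Finset.sum_congr rfl fun a _ => Finset.sum_congr rfl fun b _ => by ring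
  have hI : ∀ a b, Integrable (fun g : Fin d → ℝ => (A i a * A j b) * (g a * g b))
      (gaussianVec d 1) := fun a b =>
    ((gv_memLp d 1 a).integrable_mul (gv_memLp d 1 b)).const_mul _
  simp_rw [e]
  refine ⟨integrable_finsetSum _ fun a _ => integrable_finsetSum _ fun b _ => hI a b, ?_⟩
  rw [integral_finsetSum _ fun a _ => integrable_finsetSum _ fun b _ => hI a b, Matrix.mul_apply]
  refine Finset.sum_congr rfl fun a _ => ?_
  rw [integral_finsetSum _ fun b _ => hI a b]
  simp_rw [integral_const_mul, gv_cov d 1 zero_le_one]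
  simp


/-- for `Δ = ŵ_D − w̄`,
`E_D[ΔΔᵀ] = (1/(1+Λ))²(σ_m² + ∑_k λ_k²σ_k²)·Σ_x⁻¹/(N−d−1)`, and the resulting
variance term is `E_{D,x}[(xᵀΔ)²] = ((σ_m² + ∑_k λ_k²σ_k²)/(1+Λ)²)·d/(N−d−1)`. -/
theorem variance_of_estimator
    (N d K : ℕ) (hN : d + 1 < N)
    (Sigx : Matrix (Fin d) (Fin d) ℝ) (hSig : Sigx.PosDef)
    (A : Matrix (Fin d) (Fin d) ℝ) (hA : A * Aᵀ = Sigx)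
    (wm : Fin d → ℝ) (wk : Fin K → Fin d → ℝ)
    (σm : ℝ) (hσm : 0 < σm) (σa : Fin K → ℝ) (hσa : ∀ k, 0 < σa k)
    (lam : Fin K → ℝ) (hlam : ∀ k, 0 ≤ lam k) :
    (Matrix.of fun i j =>
        ∫ ω, (wHat A wm wk lam ω i - wBar N d K A wm wk lam σm σa i) *
          (wHat A wm wk lam ω j - wBar N d K A wm wk lam σm σa j) ∂(P N d K σm σa)) =
        ((1 / (1 + ∑ k, lam k)) ^ 2 * (σm ^ 2 + ∑ k, lam k ^ 2 * σa k ^ 2) *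
          (1 / ((N : ℝ) - (d : ℝ) - 1))) • Sigx⁻¹ ∧
      (∫ ωg : Sample N d K × (Fin d → ℝ),
          ((A *ᵥ ωg.2) ⬝ᵥ (wHat A wm wk lam ωg.1 - wBar N d K A wm wk lam σm σa)) ^ 2
          ∂((P N d K σm σa).prod (gaussianVec d 1))) =
        ((σm ^ 2 + ∑ k, lam k ^ 2 * σa k ^ 2) / (1 + ∑ k, lam k) ^ 2) *
          ((d : ℝ) / ((N : ℝ) - (d : ℝ) - 1)) := by
  have hAu : IsUnit A.det := by
    have h := hSig.det_pos
    rw [← hA, Matrix.det_mul, Matrix.det_transpose] at h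
    rw [isUnit_iff_ne_zero]
    rintro h0; rw [h0] at h; simp at h
  have hM := delta_moments N d K hN Sigx A hA hAu wm wk σm σa lam
  refine ⟨?_, ?_⟩
  · ext i j
    rw [Matrix.of_apply, (hM i j).2, Matrix.smul_apply, smul_eq_mul]
  · have e : ∀ ωg : Sample N d K × (Fin d → ℝ),
        ((A *ᵥ ωg.2) ⬝ᵥ (wHat A wm wk lam ωg.1 - wBar N d K A wm wk lam σm σa)) ^ 2 =
        ∑ i, ∑ j, ((wHat A wm wk lam ωg.1 i - wBar N d K A wm wk lam σm σa i) *
          (wHat A wm wk lam ωg.1 j - wBar N d K A wm wk lam σm σa j)) *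
          ((A *ᵥ ωg.2) i * (A *ᵥ ωg.2) j) := by
      intro ωg
      rw [sq, dotProduct, Finset.sum_mul_sum]
      exact Finset.sum_congr rfl fun a _ => Finset.sum_congr rfl fun b _ => by
        simp only [Pi.sub_apply]; ring
    haveI : IsProbabilityMeasure (P N d K σm σa) := by rw [P_eq]; infer_instance
    have hI : ∀ i j, Integrable (fun ωg : Sample N d K × (Fin d → ℝ) =>
        ((wHat A wm wk lam ωg.1 i - wBar N d K A wm wk lam σm σa i) *
          (wHat A wm wk lam ωg.1 j - wBar N d K A wm wk lam σm σa j)) *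
          ((A *ᵥ ωg.2) i * (A *ᵥ ωg.2) j)) ((P N d K σm σa).prod (gaussianVec d 1)) :=
      fun i j => (hM i j).1.mul_prod (g_moments A i j).1
    simp_rw [e]
    rw [integral_finsetSum _ fun i _ => integrable_finsetSum _ fun j _ => hI i j]
    have e2 : ∀ i, ∫ ωg : Sample N d K × (Fin d → ℝ),
        ∑ j, ((wHat A wm wk lam ωg.1 i - wBar N d K A wm wk lam σm σa i) *
          (wHat A wm wk lam ωg.1 j - wBar N d K A wm wk lam σm σa j)) *
          ((A *ᵥ ωg.2) i * (A *ᵥ ωg.2) j) ∂((P N d K σm σa).prod (gaussianVec d 1)) =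
        ((1 / (1 + ∑ k, lam k)) ^ 2 * (σm ^ 2 + ∑ k, lam k ^ 2 * σa k ^ 2) *
          (1 / ((N : ℝ) - (d : ℝ) - 1))) := by
      intro i
      rw [integral_finsetSum _ fun j _ => hI i j]
      have e3 : ∀ j, ∫ ωg : Sample N d K × (Fin d → ℝ),
        ((wHat A wm wk lam ωg.1 i - wBar N d K A wm wk lam σm σa i) *
          (wHat A wm wk lam ωg.1 j - wBar N d K A wm wk lam σm σa j)) *
          ((A *ᵥ ωg.2) i * (A *ᵥ ωg.2) j) ∂((P N d K σm σa).prod (gaussianVec d 1)) =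
        ((1 / (1 + ∑ k, lam k)) ^ 2 * (σm ^ 2 + ∑ k, lam k ^ 2 * σa k ^ 2) *
          (1 / ((N : ℝ) - (d : ℝ) - 1))) * (Sigx⁻¹ i j * Sigxᵀ j i) := by
        intro j
        rw [integral_prod_mul (fun ω => (wHat A wm wk lam ω i - wBar N d K A wm wk lam σm σa i) *
          (wHat A wm wk lam ω j - wBar N d K A wm wk lam σm σa j))
          (fun g => (A *ᵥ g) i * (A *ᵥ g) j), (hM i j).2, (g_moments A i j).2, hA,
          Matrix.transpose_apply, mul_assoc]
      simp_rw [e3]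
      have hsym : Sigxᵀ = Sigx := by
        rw [← hA, Matrix.transpose_mul, Matrix.transpose_transpose]
      rw [← Finset.mul_sum, ← Matrix.mul_apply, hsym, Matrix.nonsing_inv_mul _
        (isUnit_iff_ne_zero.2 hSig.det_pos.ne'), Matrix.one_apply_eq, mul_one]
    simp_rw [e2]
    rw [Finset.sum_const, Finset.card_univ, Fintype.card_fin, nsmul_eq_mul]
    rw [one_div, inv_pow]
    ring

end Stmt17
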